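/- For every ε₀ ∈ (0, π) and every A ≥ 1 there exist constants C > 0 and τ₀ ∈ (0,1), depending only on ε₀ and A, such that for all τ ∈ (0, τ₀), all t₁, t₂ with A⁻¹ τ^{−1/2} < t₁, t₂ < A τ^{−1/2}, and all P₁, P₂ ∈ S³ with geodesic distance d(P₁,P₂) ≥ ε₀, one has 0 ≤ ∫_{S³} δ_{P₁,t₁}(x)^{2−τ} δ_{P₂,t₂}(x) dx ≤ C τ. -/

import Mathlib

open MeasureTheory Real Set Metric
open scoped RealInnerProductSpace

noncomputable section

/-- The unit sphere `S³ ⊂ ℝ⁴`. -/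
abbrev S3 : Set (EuclideanSpace ℝ (Fin 4)) := Metric.sphere (0 : EuclideanSpace ℝ (Fin 4)) 1

/-- The surface (Riemannian volume) measure on `S³`, realized as the measure on the unit
sphere induced by the Lebesgue measure of `ℝ⁴` (so that the total mass is `2π²`). -/
def μS3 : Measure S3 := (volume : Measure (EuclideanSpace ℝ (Fin 4))).toSphere

/-- The standard bubble `δ_{P,t}(x) = t / (1 + ((t²−1)/2)(1 − ⟨x,P⟩))` on `S³`. -/
def bubble (P : S3) (t : ℝ) (x : S3) : ℝ :=
  t / (1 + ((t ^ 2 - 1) / 2) *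
    (1 - ⟪(x : EuclideanSpace ℝ (Fin 4)), (P : EuclideanSpace ℝ (Fin 4))⟫))

/-- The geodesic distance on the unit sphere: `d(P,Q) = arccos ⟨P,Q⟩`. -/
def geoDist (P Q : S3) : ℝ :=
  Real.arccos ⟪(P : EuclideanSpace ℝ (Fin 4)), (Q : EuclideanSpace ℝ (Fin 4))⟫

/-- The Green's function `G_P(Q) = 1/(1 − ⟨P,Q⟩) = 1/(1 − cos d(P,Q))`. -/
def green (P Q : S3) : ℝ :=
  1 / (1 - ⟪(P : EuclideanSpace ℝ (Fin 4)), (Q : EuclideanSpace ℝ (Fin 4))⟫)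

/-- The ambient Euclidean space of `S³`. -/
abbrev E4 := EuclideanSpace ℝ (Fin 4)

lemma norm_S3 (x : S3) : ‖(x : E4)‖ = 1 := by simp

lemma inner_S3_le_one (x P : S3) : ⟪(x : E4), (P : E4)⟫ ≤ 1 := by
  simpa [norm_S3] using real_inner_le_norm (x : E4) (P : E4)

lemma neg_one_le_inner_S3 (x P : S3) : -1 ≤ ⟪(x : E4), (P : E4)⟫ := by
  simpa [norm_S3] using neg_le_of_abs_le (abs_real_inner_le_norm (x : E4) (P : E4))

lemma norm_sub_sq_S3 (x P : S3) : ‖(x : E4) - P‖ ^ 2 = 2 * (1 - ⟪(x : E4), (P : E4)⟫) := by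
  rw [norm_sub_sq_real, norm_S3, norm_S3]; ring

instance : IsFiniteMeasure μS3 := by unfold μS3; infer_instance

lemma exists_orthonormalBasis_zero_eq (P : S3) :
    ∃ b : OrthonormalBasis (Fin 4) ℝ E4, b 0 = P := by
  obtain ⟨b, hb⟩ := Orthonormal.exists_orthonormalBasis_extension_of_card_eq (𝕜 := ℝ) (E := E4)
    (ι := Fin 4) (by simp) (v := fun _ => (P : E4)) (s := {0}) (by
      rw [orthonormal_iff_ite]
      rintro ⟨i, hi⟩ ⟨j, hj⟩
      obtain rfl : i = 0 := hi
      obtain rfl : j = 0 := hj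
      simp)
  exact ⟨b, hb 0 rfl⟩

open scoped Pointwise in
/-- The cap of chordal radius `R` on `S³` has measure `O(R³)`. -/
lemma μS3_cap_le (P : S3) {R : ℝ} (hR : 0 ≤ R) :
    μS3 {x | 2 * (1 - ⟪(x : E4), (P : E4)⟫) ≤ R ^ 2} ≤ ENNReal.ofReal (64 * R ^ 3) := by
  have hmeas : MeasurableSet {x : S3 | 2 * (1 - ⟪(x : E4), (P : E4)⟫) ≤ R ^ 2} :=
    (isClosed_le (by fun_prop) continuous_const).measurableSet
  obtain ⟨b, hb⟩ := exists_orthonormalBasis_zero_eq P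
  set l : Fin 4 → ℝ := ![1, R, R, R]
  have hsub : Ioo (0 : ℝ) 1 • (Subtype.val '' {x : S3 | 2 * (1 - ⟪(x : E4), (P : E4)⟫) ≤ R ^ 2})
      ⊆ (fun y => WithLp.ofLp (b.repr y)) ⁻¹' Icc (-l) l := by
    rintro _ ⟨r, ⟨hr0, hr1⟩, _, ⟨x, hx, rfl⟩, rfl⟩
    have hsum := b.sum_sq_norm_inner_right (x : E4)
    rw [norm_S3, Fin.sum_univ_four, hb, real_inner_comm] at hsum
    simp only [Real.norm_eq_abs, sq_abs] at hsum
    simp only [mem_ofPred_eq] at hx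
    have h1 := inner_S3_le_one x P
    have h2 := neg_one_le_inner_S3 x P
    set p := ⟪(x : E4), (P : E4)⟫
    have key : ∀ i, |⟪b i, (x : E4)⟫| ≤ l i := by
      intro i
      fin_cases i
      · change |⟪b 0, (x : E4)⟫| ≤ 1
        rw [hb, real_inner_comm]
        exact abs_le.2 ⟨h2, h1⟩
      all_goals
        refine abs_le_of_sq_le_sq ?_ hR
        simp only [Fin.mk_one, Fin.reduceFinMk]
        change _ ≤ R ^ 2
        nlinarith [sq_nonneg ⟪b 1, (x : E4)⟫, sq_nonneg ⟪b 2, (x : E4)⟫,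
          sq_nonneg ⟪b 3, (x : E4)⟫]
    have key' : ∀ i, |(b.repr (r • (x : E4))).ofLp i| ≤ l i := by
      intro i
      rw [b.repr_apply_apply, inner_smul_right, abs_mul, abs_of_pos hr0]
      exact (mul_le_of_le_one_left (abs_nonneg _) hr1.le).trans (key i)
    exact ⟨fun i => (abs_le.1 (key' i)).1, fun i => (abs_le.1 (key' i)).2⟩
  have hmp : MeasurePreserving (fun y : E4 => WithLp.ofLp (b.repr y)) volume volume :=
    (PiLp.volume_preserving_ofLp (Fin 4)).comp b.measurePreserving_repr
  rw [μS3, Measure.toSphere_apply' _ hmeas]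
  calc _ ≤ ((Module.finrank ℝ E4 : ℕ) : ENNReal) * volume (Icc (-l) l) := by
        gcongr
        rw [← hmp.measure_preimage measurableSet_Icc.nullMeasurableSet]
        exact measure_mono hsub
    _ = ENNReal.ofReal (64 * R ^ 3) := by
        rw [Real.volume_Icc_pi, ← ENNReal.ofReal_prod_of_nonneg, finrank_euclideanSpace_fin,
          ← ENNReal.ofReal_natCast, ← ENNReal.ofReal_mul (by positivity), Fin.prod_univ_four]
        · congr 1; simp [l]; ring
        · intro i _
          fin_cases i <;> simp [l] <;> linarith

section bubble

variable {t : ℝ}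

lemma bubble_denom_pos (ht : 1 ≤ t) (P x : S3) :
    0 < 1 + ((t ^ 2 - 1) / 2) * (1 - ⟪(x : E4), (P : E4)⟫) := by
  have := mul_nonneg (show 0 ≤ (t ^ 2 - 1) / 2 by nlinarith)
    (sub_nonneg.2 (inner_S3_le_one x P))
  linarith

lemma bubble_pos (ht : 1 ≤ t) (P x : S3) : 0 < bubble P t x :=
  div_pos (by linarith) (bubble_denom_pos ht P x)

lemma bubble_le (ht : 1 ≤ t) (P x : S3) : bubble P t x ≤ t := by
  refine div_le_self (by linarith) ?_
  have := mul_nonneg (show 0 ≤ (t ^ 2 - 1) / 2 by nlinarith)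
    (sub_nonneg.2 (inner_S3_le_one x P))
  linarith

lemma inv_le_bubble (ht : 1 ≤ t) (P x : S3) : t⁻¹ ≤ bubble P t x := by
  have h0 := neg_one_le_inner_S3 x P
  rw [bubble, inv_eq_one_div, div_le_div_iff₀ (by linarith) (bubble_denom_pos ht P x)]
  nlinarith [mul_nonneg (show 0 ≤ (t ^ 2 - 1) / 2 by nlinarith)
    (show 0 ≤ 1 + ⟪(x : E4), (P : E4)⟫ by linarith)]

lemma bubble_mul_le (ht : 2 ≤ t) (P x : S3) :
    bubble P t x * (t * (1 - ⟪(x : E4), (P : E4)⟫)) ≤ 4 := by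
  have h0 := sub_nonneg.2 (inner_S3_le_one x P)
  rw [bubble, div_mul_eq_mul_div, div_le_iff₀ (bubble_denom_pos (by linarith) P x)]
  nlinarith [mul_nonneg (show 0 ≤ t ^ 2 - 2 by nlinarith) h0]

lemma continuous_bubble (ht : 1 ≤ t) (P : S3) : Continuous (bubble P t) := by
  unfold bubble
  exact continuous_const.div (by fun_prop) fun x => (bubble_denom_pos ht P x).ne'

lemma integrable_bubble_sq (ht : 1 ≤ t) (P : S3) : Integrable (fun x => bubble P t x ^ 2) μS3 :=
  ((continuous_bubble ht P).pow 2).integrable_of_hasCompactSupport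
    (HasCompactSupport.of_compactSpace _)

lemma μS3_le_bubble_le (ht : 2 ≤ t) (P : S3) {v : ℝ} (hv : 0 < v) :
    μS3 {x | v ≤ bubble P t x} ≤ ENNReal.ofReal (64 * √(8 / (t * v)) ^ 3) := by
  refine (measure_mono fun x hx => ?_).trans (μS3_cap_le P (Real.sqrt_nonneg _))
  have h0 := sub_nonneg.2 (inner_S3_le_one x P)
  have ht0 : 0 < t := by linarith
  simp only [mem_ofPred_eq] at hx ⊢
  rw [Real.sq_sqrt (by positivity), le_div_iff₀ (by positivity)]
  nlinarith [bubble_mul_le ht P x, mul_le_mul_of_nonneg_right hx (mul_nonneg ht0.le h0)]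

lemma integral_bubble_sq_le (ht : 2 ≤ t) (P : S3) :
    ∫ x, bubble P t x ^ 2 ∂μS3 ≤ 6144 / t := by
  have ht0 : 0 < t := by linarith
  have ht1 : 1 ≤ t := by linarith
  set K : ℝ := 128 * (8 / t) * √(8 / t)
  have hK : 0 ≤ K := by positivity
  have hint : IntegrableOn (fun v : ℝ => K * v ^ (-(1 / 2) : ℝ)) (Ioc 0 t) :=
    ((intervalIntegrable_iff_integrableOn_Ioc_of_le ht0.le).1
      (intervalIntegral.intervalIntegrable_rpow' (by norm_num))).const_mul K
  have hval : ∫ v in Ioc 0 t, K * v ^ (-(1 / 2) : ℝ) ≤ 6144 / t := by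
    rw [integral_const_mul, ← intervalIntegral.integral_of_le ht0.le,
      integral_rpow (Or.inl (by norm_num)), Real.zero_rpow (by norm_num)]
    rw [show (-(1 / 2) + 1 : ℝ) = 1 / 2 by norm_num, ← Real.sqrt_eq_rpow, sub_zero]
    have h8 : √(8 / t) * √t = √8 := by
      rw [← Real.sqrt_mul (by positivity), div_mul_cancel₀ _ ht0.ne']
    have h9 : √8 ≤ 3 := Real.sqrt_le_iff.2 ⟨by norm_num, by norm_num⟩
    calc K * (√t / (1 / 2)) = 2048 / t * (√(8 / t) * √t) := by simp only [K]; ring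
      _ ≤ 2048 / t * 3 := by rw [h8]; gcongr
      _ = 6144 / t := by ring
  refine le_trans ?_ hval
  have hnn : ∀ v ∈ Ioc 0 t, 0 ≤ K * v ^ (-(1 / 2) : ℝ) := fun v hv =>
    mul_nonneg hK (Real.rpow_nonneg hv.1.le _)
  rw [← ENNReal.ofReal_le_ofReal_iff (setIntegral_nonneg measurableSet_Ioc hnn),
    ofReal_integral_eq_lintegral_ofReal (integrable_bubble_sq ht1 P)
      (Filter.Eventually.of_forall fun x => sq_nonneg _),
    ofReal_integral_eq_lintegral_ofReal hint
      ((ae_restrict_iff' measurableSet_Ioc).2 (Filter.Eventually.of_forall hnn))]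
  have hlc := lintegral_rpow_eq_lintegral_meas_le_mul μS3 (f := bubble P t)
    (Filter.Eventually.of_forall fun x => (bubble_pos ht1 P x).le)
    (continuous_bubble ht1 P).aemeasurable two_pos
  simp only [Real.rpow_two] at hlc
  rw [hlc, ← lintegral_const_mul' _ _ ENNReal.ofReal_ne_top, ← lintegral_indicator measurableSet_Ioi,
    ← lintegral_indicator measurableSet_Ioc]
  refine lintegral_mono fun v => ?_
  rcases le_or_gt v 0 with hv | hv
  · rw [indicator_of_notMem (by simpa using hv)]; exact zero_le
  rw [indicator_of_mem (show v ∈ Ioi 0 from hv)]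
  rcases lt_or_ge t v with htv | htv
  · have : {x | v ≤ bubble P t x} = ∅ :=
      eq_empty_of_forall_notMem fun x hx => (htv.trans_le hx).not_ge (bubble_le ht1 P x)
    simp [this]
  rw [indicator_of_mem (show v ∈ Ioc 0 t from ⟨hv, htv⟩)]
  calc _ ≤ ENNReal.ofReal 2 * (ENNReal.ofReal (64 * √(8 / (t * v)) ^ 3) *
        ENNReal.ofReal (v ^ ((2 : ℝ) - 1))) := by gcongr; exact μS3_le_bubble_le ht P hv
    _ = ENNReal.ofReal (K * v ^ (-(1 / 2) : ℝ)) := by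
      rw [← ENNReal.ofReal_mul (by positivity), ← ENNReal.ofReal_mul (by positivity)]
      congr 1
      have h1 : √(8 / (t * v)) ^ 3 = 8 / (t * v) * √(8 / (t * v)) := by
        rw [pow_succ, Real.sq_sqrt (by positivity)]
      have h2 : √(8 / (t * v)) = √(8 / t) * v ^ (-(1 / 2) : ℝ) := by
        rw [Real.rpow_neg hv.le, ← Real.sqrt_eq_rpow, ← div_div, Real.sqrt_div' _ hv.le]
        rfl
      rw [h1, h2, show (2 : ℝ) - 1 = 1 by norm_num, Real.rpow_one]
      simp only [K]
      field_simp
      ring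

end bubble

lemma inner_le_cos_of_le_geoDist {ε : ℝ} {P Q : S3} (hε : 0 ≤ ε) (h : ε ≤ geoDist P Q) :
    ⟪(P : E4), (Q : E4)⟫ ≤ cos ε := by
  rw [← Real.cos_arccos (neg_one_le_inner_S3 P Q) (inner_S3_le_one P Q)]
  exact Real.cos_le_cos_of_nonneg_of_le_pi hε (Real.arccos_le_pi _) h

lemma one_sub_inner_le_add (P Q x : S3) :
    1 - ⟪(P : E4), (Q : E4)⟫ ≤
      2 * ((1 - ⟪(x : E4), (P : E4)⟫) + (1 - ⟪(x : E4), (Q : E4)⟫)) := by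
  have h := norm_sub_le_norm_sub_add_norm_sub (P : E4) (x : E4) (Q : E4)
  rw [norm_sub_rev (P : E4) x] at h
  have h1 := norm_sub_sq_S3 P Q
  have h2 := norm_sub_sq_S3 x P
  have h3 := norm_sub_sq_S3 x Q
  nlinarith [norm_nonneg ((P : E4) - Q), sq_nonneg (‖(x : E4) - P‖ - ‖(x : E4) - Q‖)]

lemma bubble_sq_mul_bubble_le {c t₁ t₂ : ℝ} {P₁ P₂ : S3} (hc : 0 < c) (ht₁ : 2 ≤ t₁) (ht₂ : 2 ≤ t₂)
    (h : 4 * c ≤ 1 - ⟪(P₁ : E4), (P₂ : E4)⟫) (x : S3) :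
    bubble P₁ t₁ x ^ 2 * bubble P₂ t₂ x ≤
      4 / (c * t₂) * bubble P₁ t₁ x ^ 2 + 16 / (c * t₁) ^ 2 * (1 + bubble P₂ t₂ x ^ 2) := by
  have h1 := bubble_pos (by linarith : 1 ≤ t₁) P₁ x
  have h2 := bubble_pos (by linarith : 1 ≤ t₂) P₂ x
  have h3 := bubble_mul_le ht₁ P₁ x
  have h4 := bubble_mul_le ht₂ P₂ x
  have h5 := one_sub_inner_le_add P₁ P₂ x
  have hu : c ≤ 1 - ⟪(x : E4), (P₁ : E4)⟫ ∨ c ≤ 1 - ⟪(x : E4), (P₂ : E4)⟫ := by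
    by_contra! hh
    linarith [hh.1, hh.2]
  rcases hu with hu | hu
  · have hb : bubble P₁ t₁ x ≤ 4 / (c * t₁) := by
      rw [le_div_iff₀ (by positivity)]
      refine le_trans ?_ h3
      rw [mul_comm c]
      gcongr
    calc _ ≤ (4 / (c * t₁)) ^ 2 * (1 + bubble P₂ t₂ x ^ 2) := by
          gcongr
          nlinarith [sq_nonneg (bubble P₂ t₂ x - 1)]
      _ = 16 / (c * t₁) ^ 2 * (1 + bubble P₂ t₂ x ^ 2) := by rw [div_pow]; norm_num
      _ ≤ _ := le_add_of_nonneg_left (by positivity)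
  · have hb : bubble P₂ t₂ x ≤ 4 / (c * t₂) := by
      rw [le_div_iff₀ (by positivity)]
      refine le_trans ?_ h4
      rw [mul_comm c]
      gcongr
    calc _ ≤ bubble P₁ t₁ x ^ 2 * (4 / (c * t₂)) := by gcongr
      _ = 4 / (c * t₂) * bubble P₁ t₁ x ^ 2 := mul_comm _ _
      _ ≤ _ := le_add_of_nonneg_right (by positivity)

lemma bubble_rpow_two_sub_le {t τ B : ℝ} (ht : 1 ≤ t) (hτ : 0 ≤ τ) (hB : τ * t ≤ B) (P x : S3) :
    bubble P t x ^ ((2 : ℝ) - τ) ≤ exp B * bubble P t x ^ 2 := by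
  have h1 := bubble_pos ht P x
  have ht0 : 0 < t := by linarith
  rw [sub_eq_neg_add, Real.rpow_add h1, Real.rpow_two]
  gcongr
  calc bubble P t x ^ (-τ) ≤ (t⁻¹) ^ (-τ) :=
        Real.rpow_le_rpow_of_nonpos (by positivity) (inv_le_bubble ht P x) (by linarith)
    _ = exp (log t * τ) := by
        rw [Real.inv_rpow ht0.le, Real.rpow_neg ht0.le, inv_inv, Real.rpow_def_of_pos ht0]
    _ ≤ exp B := by
        gcongr
        nlinarith [Real.log_le_sub_one_of_pos ht0]

lemma integral_bubble_rpow_mul_bubble_le {c t₁ t₂ τ B : ℝ} {P₁ P₂ : S3} (hc : 0 < c)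
    (ht₁ : 2 ≤ t₁) (ht₂ : 2 ≤ t₂) (hτ : 0 ≤ τ) (hB : τ * t₁ ≤ B)
    (h : 4 * c ≤ 1 - ⟪(P₁ : E4), (P₂ : E4)⟫) :
    ∫ x, (bubble P₁ t₁ x) ^ ((2 : ℝ) - τ) * bubble P₂ t₂ x ∂μS3 ≤
      exp B * (4 / (c * t₂) * (6144 / t₁) + 16 / (c * t₁) ^ 2 * (μS3.real univ + 6144 / t₂)) := by
  have h1 := fun x => bubble_pos (by linarith : 1 ≤ t₁) P₁ x
  have h2 := fun x => bubble_pos (by linarith : 1 ≤ t₂) P₂ x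
  have i1 := integrable_bubble_sq (by linarith : 1 ≤ t₁) P₁
  have i2 := integrable_bubble_sq (by linarith : 1 ≤ t₂) P₂
  have i3 : Integrable (fun x => 1 + bubble P₂ t₂ x ^ 2) μS3 := (integrable_const 1).add i2
  calc _ ≤ ∫ x, exp B * (4 / (c * t₂) * bubble P₁ t₁ x ^ 2 +
        16 / (c * t₁) ^ 2 * (1 + bubble P₂ t₂ x ^ 2)) ∂μS3 := by
        refine integral_mono_of_nonneg (Filter.Eventually.of_forall fun x =>
          mul_nonneg (Real.rpow_nonneg (h1 x).le _) (h2 x).le)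
          (((i1.const_mul _).add (i3.const_mul _)).const_mul _)
          (Filter.Eventually.of_forall fun x => ?_)
        calc _ ≤ exp B * bubble P₁ t₁ x ^ 2 * bubble P₂ t₂ x :=
              mul_le_mul_of_nonneg_right (bubble_rpow_two_sub_le (by linarith) hτ hB P₁ x) (h2 x).le
          _ ≤ _ := by
              rw [mul_assoc]
              exact mul_le_mul_of_nonneg_left (bubble_sq_mul_bubble_le hc ht₁ ht₂ h x) (exp_pos B).le
    _ = exp B * (4 / (c * t₂) * (∫ x, bubble P₁ t₁ x ^ 2 ∂μS3) +
        16 / (c * t₁) ^ 2 * (μS3.real univ + ∫ x, bubble P₂ t₂ x ^ 2 ∂μS3)) := by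
        rw [integral_const_mul, integral_add (i1.const_mul _) (i3.const_mul _),
          integral_const_mul, integral_const_mul, integral_add (integrable_const 1) i2]
        simp
    _ ≤ _ := by
        gcongr
        · exact integral_bubble_sq_le ht₁ P₁
        · exact integral_bubble_sq_le ht₂ P₂

theorem stmt11 (ε₀ A : ℝ) (hε₀ : ε₀ ∈ Set.Ioo 0 π) (hA : 1 ≤ A) :
    ∃ C > 0, ∃ τ₀ ∈ Set.Ioo (0 : ℝ) 1, ∀ τ ∈ Set.Ioo (0 : ℝ) τ₀, ∀ t₁ t₂ : ℝ,
      A⁻¹ * τ ^ (-(1 : ℝ) / 2) < t₁ → t₁ < A * τ ^ (-(1 : ℝ) / 2) →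
      A⁻¹ * τ ^ (-(1 : ℝ) / 2) < t₂ → t₂ < A * τ ^ (-(1 : ℝ) / 2) →
      ∀ P₁ P₂ : S3, ε₀ ≤ geoDist P₁ P₂ →
      0 ≤ (∫ x, (bubble P₁ t₁ x) ^ ((2 : ℝ) - τ) * bubble P₂ t₂ x ∂μS3) ∧
      (∫ x, (bubble P₁ t₁ x) ^ ((2 : ℝ) - τ) * bubble P₂ t₂ x ∂μS3) ≤ C * τ := by
  obtain ⟨c, hc, hcε⟩ : ∃ c, 0 < c ∧ 4 * c = 1 - cos ε₀ := by
    refine ⟨(1 - cos ε₀) / 4, ?_, by ring⟩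
    have := Real.cos_lt_cos_of_nonneg_of_le_pi le_rfl hε₀.2.le hε₀.1
    rw [Real.cos_zero] at this
    linarith
  have hA0 : 0 < A := by linarith
  set M := μS3.real univ
  have hM : 0 ≤ M := measureReal_nonneg
  refine ⟨exp A * (4 / c * 6144 + 16 / c ^ 2 * (M + 6144)) * A ^ 2, by positivity,
    1 / (4 * A ^ 2), ⟨by positivity, ?_⟩, ?_⟩
  · rw [div_lt_one (by positivity)]
    nlinarith
  rintro τ ⟨hτ0, hτ⟩ t₁ t₂ h1 h1' h2 h2' P₁ P₂ hP
  obtain ⟨T, hT0, hT, hTτ⟩ : ∃ T : ℝ, 0 < T ∧ τ ^ (-(1 : ℝ) / 2) = T ∧ τ * T ^ 2 = 1 := by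
    refine ⟨_, Real.rpow_pos_of_pos hτ0 _, rfl, ?_⟩
    rw [← Real.rpow_natCast, ← Real.rpow_mul hτ0.le]
    norm_num [Real.rpow_neg_one]
    exact mul_inv_cancel₀ hτ0.ne'
  rw [hT] at h1 h1' h2 h2'
  have hTA : 2 * A ≤ T := by
    rw [lt_div_iff₀ (by positivity)] at hτ
    refine (sq_le_sq₀ (by positivity) hT0.le).1 ?_
    refine le_of_mul_le_mul_left ?_ hτ0
    rw [hTτ]
    linarith
  have h1T : T ≤ A * t₁ := by
    rw [inv_mul_lt_iff₀ hA0] at h1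
    exact h1.le
  have h2T : T ≤ A * t₂ := by
    rw [inv_mul_lt_iff₀ hA0] at h2
    exact h2.le
  have ht₁ : 2 ≤ t₁ := le_of_mul_le_mul_left (by linarith) hA0
  have ht₂ : 2 ≤ t₂ := le_of_mul_le_mul_left (by linarith) hA0
  have hB : τ * t₁ ≤ A := by
    have : τ * T ≤ 1 := by nlinarith [mul_pos hτ0 hT0]
    nlinarith
  have hinv : ∀ s s' : ℝ, 2 ≤ s → 2 ≤ s' → T ≤ A * s → T ≤ A * s' → 1 / (s * s') ≤ A ^ 2 * τ := by
    intro s s' hs hs' hT hT'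
    rw [div_le_iff₀ (by positivity)]
    calc 1 = τ * (T * T) := by rw [← hTτ]; ring
      _ ≤ τ * ((A * s) * (A * s')) := by gcongr
      _ = A ^ 2 * τ * (s * s') := by ring
  refine ⟨integral_nonneg fun x => mul_nonneg
    (Real.rpow_nonneg (bubble_pos (by linarith) P₁ x).le _)
    (bubble_pos (by linarith) P₂ x).le, ?_⟩
  have hi := inner_le_cos_of_le_geoDist hε₀.1.le hP
  refine (integral_bubble_rpow_mul_bubble_le hc ht₁ ht₂ hτ0.le hB (by linarith)).trans ?_
  calc _ = exp A * (4 / c * 6144 * (1 / (t₁ * t₂)) +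
        16 / c ^ 2 * (M + 6144 / t₂) * (1 / (t₁ * t₁))) := by
        simp only [M]
        field_simp
    _ ≤ exp A * (4 / c * 6144 * (A ^ 2 * τ) + 16 / c ^ 2 * (M + 6144) * (A ^ 2 * τ)) := by
        gcongr
        · exact hinv _ _ ht₁ ht₂ h1T h2T
        · exact div_le_self (by norm_num) (by linarith)
        · exact hinv _ _ ht₁ ht₁ h1T h1T
    _ = _ := by ring
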